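/- arXiv:2206.07452 — 2 statements merged into one kernel-verified Lean document; each statement's English description precedes it below -/
import Mathlib

section
/- Let (A, μ, α, β) be a BiHom-alternative algebra over K, V a K-vector space, ℓ, r: A → End(V) linear maps, and φ, ψ ∈ End(V) with φψ = ψφ. Then (V, ℓ, r, φ, ψ) is a representation of (A, μ, α, β) if and only if the direct sum A ⊕ V with product (x₁+v₁) ∗ (x₂+v₂) = μ(x₁,x₂) + ℓ(x₁)v₂ + r(x₂)v₁ and structure maps (α+φ)(x+v) = α(x)+φ(v), (β+ψ)(x+v) = β(x)+ψ(v) is a BiHom-alternative algebra (the semidirect product). -/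
/-- The BiHom-associator `as_{α,β}(x,y,z) = (xy)β(z) − α(x)(yz)`. -/
def biAssoc {A : Type*} [AddCommGroup A] (mul : A → A → A) (α β : A → A)
    (x y z : A) : A :=
  mul (mul x y) (β z) - mul (α x) (mul y z)

/-- A BiHom-algebra `(A, μ, α, β)`. -/
structure IsBiHomAlg (K : Type*) {A : Type*} [Field K] [AddCommGroup A] [Module K A]
    (mul : A → A → A) (α β : A → A) : Prop where
  mul_lin_left : ∀ y, IsLinearMap K fun x => mul x y
  mul_lin_right : ∀ x, IsLinearMap K (mul x)
  alpha_lin : IsLinearMap K α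
  beta_lin : IsLinearMap K β
  alpha_beta_comm : ∀ x, α (β x) = β (α x)
  alpha_mul : ∀ x y, α (mul x y) = mul (α x) (α y)
  beta_mul : ∀ x y, β (mul x y) = mul (β x) (β y)

/-- A BiHom-alternative algebra: a BiHom-algebra satisfying both the left and the
right BiHom-alternative identities. -/
structure IsBiHomAlt (K : Type*) {A : Type*} [Field K] [AddCommGroup A] [Module K A]
    (mul : A → A → A) (α β : A → A) extends IsBiHomAlg K mul α β : Prop where
  left_alt : ∀ x y z,
    biAssoc mul α β (β x) (α y) z + biAssoc mul α β (β y) (α x) z = 0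
  right_alt : ∀ x y z,
    biAssoc mul α β x (β y) (α z) + biAssoc mul α β x (β z) (α y) = 0

/-- A representation (bimodule) `(V, ℓ, r, φ, ψ)` of a BiHom-alternative algebra
`(A, μ, α, β)`. -/
structure IsBiHomRep (K : Type*) {A V : Type*} [Field K] [AddCommGroup A] [Module K A]
    [AddCommGroup V] [Module K V] (mul : A → A → A) (α β : A → A)
    (l r : A → Module.End K V) (φ ψ : Module.End K V) : Prop where
  l_lin : IsLinearMap K l
  r_lin : IsLinearMap K r
  phi_psi_comm : ∀ v, φ (ψ v) = ψ (φ v)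
  phi_l : ∀ x v, φ (l x v) = l (α x) (φ v)
  phi_r : ∀ x v, φ (r x v) = r (α x) (φ v)
  psi_l : ∀ x v, ψ (l x v) = l (β x) (ψ v)
  psi_r : ∀ x v, ψ (r x v) = r (β x) (ψ v)
  rep1 : ∀ x v, l (mul (β x) (α x)) (ψ v) = l (α (β x)) (l (α x) v)
  rep2 : ∀ x v, r (mul (β x) (α x)) (φ v) = r (α (β x)) (r (β x) v)
  rep3 : ∀ x y v, r (β y) (l (β x) (φ v)) - l (α (β x)) (r y (φ v))
      = r (mul (α x) y) (φ (ψ v)) - r (β y) (r (α x) (ψ v))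
  rep4 : ∀ x y v, l (α y) (r (α x) (ψ v)) - r (α (β x)) (l y (ψ v))
      = l (mul y (β x)) (φ (ψ v)) - l (α y) (l (β x) (φ v))

/-- `(V, ℓ, r, φ, ψ)` is a representation of the BiHom-alternative algebra
`(A, μ, α, β)` iff the semidirect product `A ⊕ V` with product
`(x₁+v₁) ∗ (x₂+v₂) = μ(x₁,x₂) + ℓ(x₁)v₂ + r(x₂)v₁` and structure maps
`α+φ`, `β+ψ` is a BiHom-alternative algebra. -/
theorem isBiHomRep_iff_semidirect_isBiHomAlt
    (K : Type*) [Field K] [CharZero K] {A V : Type*} [AddCommGroup A] [Module K A]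
    [AddCommGroup V] [Module K V]
    (mul : A → A → A) (α β : A → A) (halg : IsBiHomAlt K mul α β)
    (l r : A → Module.End K V) (hl : IsLinearMap K l) (hr : IsLinearMap K r)
    (φ ψ : Module.End K V) (hcomm : ∀ v, φ (ψ v) = ψ (φ v)) :
    IsBiHomRep K mul α β l r φ ψ ↔
      IsBiHomAlt K (fun p q : A × V => (mul p.1 q.1, l p.1 q.2 + r q.1 p.2))
        (fun p => (α p.1, φ p.2)) (fun p => (β p.1, ψ p.2)) := by
  obtain ⟨⟨mll, mlr, al, bl, abc, am, bm⟩, la, ra⟩ := halg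
  have l0 : l 0 = 0 := hl.map_zero
  have r0 : r 0 = 0 := hr.map_zero
  have a0 : α 0 = 0 := al.map_zero
  have b0 : β 0 = 0 := bl.map_zero
  have m0 : ∀ x, mul x 0 = 0 := fun x => (mlr x).map_zero
  have m0' : ∀ x, mul 0 x = 0 := fun x => (mll x).map_zero
  have ma : ∀ x y z, mul (x + y) z = mul x z + mul y z := fun x y z => (mll z).map_add x y
  have ma' : ∀ x y z, mul x (y + z) = mul x y + mul x z := fun x y z => (mlr x).map_add y z
  have ms : ∀ (c : K) x z, mul (c • x) z = c • mul x z := fun c x z => (mll z).map_smul c x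
  have ms' : ∀ (c : K) x z, mul x (c • z) = c • mul x z := fun c x z => (mlr x).map_smul c z
  have half : ∀ a b : V, a - b + (a - b) = 0 → a = b := by
    intro a b h
    have h2 : (2 : K) • (a - b) = 0 := by rw [two_smul]; exact h
    rcases smul_eq_zero.mp h2 with h3 | h3
    · exact absurd h3 two_ne_zero
    · exact sub_eq_zero.mp h3
  constructor
  · rintro ⟨-, -, -, pl, pr, sl, sr, h1, h2, h3, h4⟩
    refine ⟨⟨?_, ?_, ?_, ?_, ?_, ?_, ?_⟩, ?_, ?_⟩
    · intro q
      constructor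
      · intro p p'
        ext
        · simp [ma]
        · simp [hl.map_add]; abel
      · intro c p
        ext
        · simp [ms]
        · simp [hl.map_smul]
    · intro q
      constructor
      · intro p p'
        ext
        · simp [ma']
        · simp [hr.map_add]; abel
      · intro c p
        ext
        · simp [ms']
        · simp [hr.map_smul]
    · constructor
      · intro p p'; ext <;> simp [al.map_add]
      · intro c p; ext <;> simp [al.map_smul]
    · constructor
      · intro p p'; ext <;> simp [bl.map_add]
      · intro c p; ext <;> simp [bl.map_smul]
    · intro p; ext <;> simp [abc, hcomm]
    · intro p q; ext <;> simp [am, pl, pr]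
    · intro p q; ext <;> simp [bm, sl, sr]
    · rintro ⟨x, u⟩ ⟨y, v⟩ ⟨z, w⟩
      ext
      · simpa [biAssoc] using la x y z
      · have e := h1 (x + y) w
        have ex := h1 x w
        have ey := h1 y w
        have e1 := h3 x z v
        have e2 := h3 y z u
        simp only [al.map_add, bl.map_add, ma, ma', hl.map_add, LinearMap.add_apply, map_add] at e
        simp only [biAssoc, Prod.snd_add, Prod.snd_sub, map_add, Prod.snd_zero]
        rw [ex, ey] at e
        linear_combination (norm := module) e + e1 + e2
    · rintro ⟨x, u⟩ ⟨y, v⟩ ⟨z, w⟩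
      ext
      · simpa [biAssoc] using ra x y z
      · have e := h2 (y + z) u
        have ex := h2 y u
        have ey := h2 z u
        have e1 := h4 y x w
        have e2 := h4 z x v
        simp only [al.map_add, bl.map_add, ma, ma', hr.map_add, LinearMap.add_apply, map_add] at e
        simp only [biAssoc, Prod.snd_add, Prod.snd_sub, map_add, Prod.snd_zero]
        rw [ex, ey] at e
        simp only [← abc, ← hcomm]
        linear_combination (norm := module) - e - e1 - e2
  · rintro ⟨⟨-, -, -, -, -, am', bm'⟩, la', ra'⟩
    refine ⟨hl, hr, hcomm, ?_, ?_, ?_, ?_, ?_, ?_, ?_, ?_⟩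
    · intro x v
      simpa [r0, a0] using congrArg Prod.snd (am' (x, 0) (0, v))
    · intro x v
      simpa [l0, a0] using congrArg Prod.snd (am' (0, v) (x, 0))
    · intro x v
      simpa [r0, b0] using congrArg Prod.snd (bm' (x, 0) (0, v))
    · intro x v
      simpa [l0, b0] using congrArg Prod.snd (bm' (0, v) (x, 0))
    · intro x v
      have := congrArg Prod.snd (la' (x, 0) (x, 0) (0, v))
      apply half
      simpa only [biAssoc, l0, r0, a0, b0, m0, m0', Prod.snd_add, Prod.snd_sub, Prod.snd_zero,
        map_zero, LinearMap.zero_apply, add_zero, zero_add] using this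
    · intro x v
      have := congrArg Prod.snd (ra' (0, v) (x, 0) (x, 0))
      apply half
      simp only [biAssoc, l0, r0, a0, b0, m0, m0', Prod.snd_add, Prod.snd_sub, Prod.snd_zero,
        map_zero, LinearMap.zero_apply, add_zero, zero_add, ← abc] at this
      linear_combination (norm := module) - this
    · intro x y v
      have := congrArg Prod.snd (la' (x, 0) (0, v) (y, 0))
      simp only [biAssoc, l0, r0, a0, b0, m0, m0', Prod.snd_add, Prod.snd_sub, Prod.snd_zero,
        map_zero, LinearMap.zero_apply, add_zero, zero_add] at this
      linear_combination (norm := module) this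
    · intro x y v
      have := congrArg Prod.snd (ra' (y, 0) (x, 0) (0, v))
      simp only [biAssoc, l0, r0, a0, b0, m0, m0', Prod.snd_add, Prod.snd_sub, Prod.snd_zero,
        map_zero, LinearMap.zero_apply, add_zero, zero_add, ← abc, ← hcomm] at this
      linear_combination (norm := module) - this
end

section
/- Let (A, μ, α, β) be a left BiHom-alternative algebra and (V, ℓ, r, φ, ψ) a representation of it. Then δ² ∘ δ¹ = 0: for every 1-cochain f on A with values in V and all x, y, z ∈ A, δ²(δ¹f)(x,y,z) = 0. -/
/-- A left BiHom-alternative algebra. -/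
structure IsLeftBiHomAlt (K : Type*) {A : Type*} [Field K] [AddCommGroup A] [Module K A]
    (mul : A → A → A) (α β : A → A) extends IsBiHomAlg K mul α β : Prop where
  left_alt : ∀ x y z,
    biAssoc mul α β (β x) (α y) z + biAssoc mul α β (β y) (α x) z = 0

/-- A 1-cochain on `A` with values in `V`. -/
structure IsCochain1 (K : Type*) {A V : Type*} [Field K] [AddCommGroup A] [Module K A]
    [AddCommGroup V] [Module K V] (α β : A → A) (φ ψ : Module.End K V)
    (f : A → V) : Prop where
  lin : IsLinearMap K f
  equiv_a : ∀ x, f (α x) = φ (f x)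
  equiv_b : ∀ x, f (β x) = ψ (f x)

/-- A 2-cochain on `A` with values in `V`. -/
structure IsCochain2 (K : Type*) {A V : Type*} [Field K] [AddCommGroup A] [Module K A]
    [AddCommGroup V] [Module K V] (α β : A → A) (φ ψ : Module.End K V)
    (f : A → A → V) : Prop where
  lin_left : ∀ y, IsLinearMap K fun x => f x y
  lin_right : ∀ x, IsLinearMap K (f x)
  equiv_a : ∀ x y, f (α x) (α y) = φ (f x y)
  equiv_b : ∀ x y, f (β x) (β y) = ψ (f x y)

/-- A 3-cochain on `A` with values in `V`. -/
structure IsCochain3 (K : Type*) {A V : Type*} [Field K] [AddCommGroup A] [Module K A]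
    [AddCommGroup V] [Module K V] (α β : A → A) (φ ψ : Module.End K V)
    (f : A → A → A → V) : Prop where
  lin1 : ∀ y z, IsLinearMap K fun x => f x y z
  lin2 : ∀ x z, IsLinearMap K fun y => f x y z
  lin3 : ∀ x y, IsLinearMap K (f x y)
  equiv_a : ∀ x y z, f (α x) (α y) (α z) = φ (f x y z)
  equiv_b : ∀ x y z, f (β x) (β y) (β z) = ψ (f x y z)

/-- The first coboundary operator `δ¹f(x,y) = ℓ(x)f(y) + r(y)f(x) − f(xy)`. -/
def delta1 {K A V : Type*} [Field K] [AddCommGroup A] [Module K A]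
    [AddCommGroup V] [Module K V] (mul : A → A → A)
    (l r : A → Module.End K V) (f : A → V) (x y : A) : V :=
  l x (f y) + r y (f x) - f (mul x y)

/-- The second coboundary operator. -/
def delta2 {K A V : Type*} [Field K] [AddCommGroup A] [Module K A]
    [AddCommGroup V] [Module K V] (mul : A → A → A) (α β : A → A)
    (l r : A → Module.End K V) (f : A → A → V) (x y z : A) : V :=
  r (β z) (f (β x) (α y)) - l (α (β x)) (f (α y) z)
    + r (β z) (f (β y) (α x)) - l (α (β y)) (f (α x) z)
    + f (mul (β x) (α y)) (β z) - f (α (β x)) (mul (α y) z)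
    + f (mul (β y) (α x)) (β z) - f (α (β y)) (mul (α x) z)

/-- The third coboundary operator. -/
def delta3 {K A V : Type*} [Field K] [AddCommGroup A] [Module K A]
    [AddCommGroup V] [Module K V] (mul : A → A → A) (α β : A → A)
    (l r : A → Module.End K V) (f : A → A → A → V) (x1 x2 x3 x4 : A) : V :=
  l (α x1) (f (β x2) (β x3) (β x4)) - l (α x1) (f (β x3) (β x2) (β x4))
    + r (β x4) (f (α x1) (α x2) (α x3)) - r (β x4) (f (α x2) (α x1) (α x3))
    - f (mul (α x1) (β x2)) x3 x4 - f (mul (α x2) (β x3)) x1 x4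
    + f x1 (mul (α x2) (β x3)) x4 + f x3 (mul (α x1) (β x2)) x4
    - f x1 x2 (mul (α x3) (β x4)) + f x2 x1 (mul (α x3) (β x4))

/-- `δ² ∘ δ¹ = 0` for the cohomology of a left BiHom-alternative algebra with
coefficients in a representation. -/
theorem delta2_comp_delta1_eq_zero
    (K : Type*) [Field K] [CharZero K] {A V : Type*} [AddCommGroup A] [Module K A]
    [AddCommGroup V] [Module K V]
    (mul : A → A → A) (α β : A → A) (halg : IsLeftBiHomAlt K mul α β)
    (l r : A → Module.End K V) (φ ψ : Module.End K V)
    (hrep : IsBiHomRep K mul α β l r φ ψ) :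
    ∀ f : A → V, IsCochain1 K α β φ ψ f →
      ∀ x y z, delta2 mul α β l r (delta1 mul l r f) x y z = 0 := by
  intro f hf x y z
  have h1 := hrep.rep1 (x + y) (f z)
  have hx := hrep.rep1 x (f z)
  have hy := hrep.rep1 y (f z)
  have h3 := hrep.rep3 x z (f y)
  have h4 := hrep.rep3 y z (f x)
  have hm : ∀ a b c, mul (a + b) c = mul a c + mul b c :=
    fun a b c => (halg.mul_lin_left c).map_add a b
  simp only [halg.alpha_lin.map_add, halg.beta_lin.map_add, hm,
    (halg.mul_lin_right _).map_add, hrep.l_lin.map_add, LinearMap.add_apply, map_add] at h1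
  have ha := congrArg f (halg.left_alt x y z)
  simp only [biAssoc, hf.lin.map_add, hf.lin.map_sub, hf.lin.map_zero] at ha
  simp only [delta2, delta1, map_add, map_sub, hf.equiv_a (β _), hf.equiv_b z, hf.equiv_b x,
    hf.equiv_b y, hf.equiv_a x, hf.equiv_a y]
  linear_combination (norm := module) h1 - hx - hy + h3 + h4 - ha
end
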